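/- arXiv:2204.00209 — 8 statements merged into one kernel-verified Lean document; each statement's English description precedes it below -/
import Mathlib

section
/- Suppose Assumptions 1 and 2 hold. Then the Nash equilibria of the green routing game are essentially unique, i.e., for any two Nash equilibria x and x̂ and every player i, J^i(x) = J^i(x̂). -/
open scoped BigOperators

noncomputable section GreenRouting

/-- `𝒳^i`: the feasible strategy set of a player with demand `D` over `R` parallel routes.
Index `0` is the demand delivered by ICEVs, index `r.succ` the EV flow on route `r`. -/
def Feasible (R : ℕ) (D : ℝ) (y : Fin (R + 1) → ℝ) : Prop :=
  (∀ k, 0 ≤ y k) ∧ ∑ k, y k = D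

/-- `𝒳`: the set of feasible flow profiles. -/
def FeasProfile {N R : ℕ} (D : Fin N → ℝ) (x : Fin N → Fin (R + 1) → ℝ) : Prop :=
  ∀ i, Feasible R (D i) (x i)

/-- Aggregated EV flow on route `r`: `X_r = ∑ i, x^i_r`. -/
def aggFlow {N R : ℕ} (x : Fin N → Fin (R + 1) → ℝ) (r : Fin R) : ℝ :=
  ∑ i, x i r.succ

/-- Player `i`'s cost `J^i(x) = α^i x^i_0 + ∑ r, x^i_r c^i_r(X_r)`. -/
def cost {N R : ℕ} (α : Fin N → ℝ) (c : Fin N → Fin R → ℝ → ℝ) (i : Fin N)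
    (x : Fin N → Fin (R + 1) → ℝ) : ℝ :=
  α i * x i 0 + ∑ r : Fin R, x i r.succ * c i r (aggFlow x r)

/-- Nash equilibrium of the green routing game. -/
def IsNash {N R : ℕ} (D α : Fin N → ℝ) (c : Fin N → Fin R → ℝ → ℝ)
    (x : Fin N → Fin (R + 1) → ℝ) : Prop :=
  FeasProfile D x ∧
    ∀ i y, Feasible R (D i) y → cost α c i x ≤ cost α c i (Function.update x i y)

/-- Assumption 1, with cost-free thresholds `χ`: each `c^i_r` vanishes up to `χ^i_r ≥ 0`,
is strictly increasing from `χ^i_r` on, is convex on `[0, ∞)` and twice continuously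
differentiable. -/
def Assumption1 {N R : ℕ} (c : Fin N → Fin R → ℝ → ℝ) (χ : Fin N → Fin R → ℝ) : Prop :=
  ∀ i r, 0 ≤ χ i r ∧ (∀ X : ℝ, X ≤ χ i r → c i r X = 0) ∧
    StrictMonoOn (c i r) (Set.Ici (χ i r)) ∧
    ConvexOn ℝ (Set.Ici 0) (c i r) ∧ ContDiff ℝ 2 (c i r)

/-- The partial gradient component `∂ J^i / ∂ x^i_k` of player `i`'s cost with respect to
her own strategy; `fun k => gradJ α c x i k` is the `i`-th block of the aggregated
gradient map `F`. -/
def gradJ {N R : ℕ} (α : Fin N → ℝ) (c : Fin N → Fin R → ℝ → ℝ)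
    (x : Fin N → Fin (R + 1) → ℝ) (i : Fin N) (k : Fin (R + 1)) : ℝ :=
  deriv (fun t => cost α c i (Function.update x i (Function.update (x i) k t))) (x i k)

/-- KKT point of the green routing game (with player-identical route cost functions `c_r`):
strategies `x` together with Lagrange multipliers `lam` and `mu` satisfying stationarity,
feasibility, and complementarity. -/
def IsKKT {N R : ℕ} (D α : Fin N → ℝ) (c : Fin R → ℝ → ℝ)
    (x : Fin N → Fin (R + 1) → ℝ) (lam : Fin N → ℝ)
    (mu : Fin N → Fin (R + 1) → ℝ) : Prop :=
  ∀ i,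
    α i = lam i + mu i 0 ∧
    (∀ r : Fin R,
      c r (aggFlow x r) + x i r.succ * deriv (c r) (aggFlow x r) = lam i + mu i r.succ) ∧
    (∑ k, x i k = D i) ∧
    ∀ k, 0 ≤ x i k ∧ mu i k * x i k = 0 ∧ 0 ≤ mu i k

/-- Condition (2) with constant `a`: for every feasible profile and every route with
`c'_r(X_r) > 0`, `2 c'_r(X_r) (1 - (c''_r(X_r) / (2 c'_r(X_r)))² ‖x_r‖²) ≥ a`. -/
def Condition2 {N R : ℕ} (D : Fin N → ℝ) (c : Fin R → ℝ → ℝ) (a : ℝ) : Prop :=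
  ∀ x : Fin N → Fin (R + 1) → ℝ, FeasProfile D x → ∀ r : Fin R,
    0 < deriv (c r) (aggFlow x r) →
    a ≤ 2 * deriv (c r) (aggFlow x r) *
        (1 - (deriv (deriv (c r)) (aggFlow x r) / (2 * deriv (c r) (aggFlow x r))) ^ 2 *
          ∑ i, (x i r.succ) ^ 2)

/-- The aggregated gradient map `F = (∇_{x^i} J^i)_i` is co-coercive with modulus `a` on `𝒳`:
`(x' - x)ᵀ (F(x') - F(x)) ≥ a ‖F(x') - F(x)‖²`. -/
def CoCoercive {N R : ℕ} (D α : Fin N → ℝ) (c : Fin N → Fin R → ℝ → ℝ) (a : ℝ) : Prop :=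
  ∀ x x' : Fin N → Fin (R + 1) → ℝ, FeasProfile D x → FeasProfile D x' →
    a * ∑ i, ∑ k, (gradJ α c x' i k - gradJ α c x i k) ^ 2 ≤
      ∑ i, ∑ k, (x' i k - x i k) * (gradJ α c x' i k - gradJ α c x i k)

/-- Squared Euclidean norm on the space of flow profiles. -/
def nsq {N R : ℕ} (v : Fin N → Fin (R + 1) → ℝ) : ℝ := ∑ i, ∑ k, (v i k) ^ 2

/-- A map on profiles is nonexpansive on a set `K`. -/
def NonexpansiveOn {N R : ℕ} (K : Set (Fin N → Fin (R + 1) → ℝ))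
    (T : (Fin N → Fin (R + 1) → ℝ) → (Fin N → Fin (R + 1) → ℝ)) : Prop :=
  ∀ x ∈ K, ∀ y ∈ K, nsq (T y - T x) ≤ nsq (y - x)

/-- A map on profiles is averaged on a set `K`: it is a strict convex combination
`(1 - β) I + β T` of the identity and a nonexpansive map `T`. -/
def AveragedOn {N R : ℕ} (K : Set (Fin N → Fin (R + 1) → ℝ))
    (G : (Fin N → Fin (R + 1) → ℝ) → (Fin N → Fin (R + 1) → ℝ)) : Prop :=
  ∃ β : ℝ, β ∈ Set.Ioo (0 : ℝ) 1 ∧ ∃ T, NonexpansiveOn K T ∧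
    ∀ x ∈ K, G x = (1 - β) • x + β • T x

/-- The Jacobian `G(x) = ∇ᵀ F(x)` of the aggregated gradient map. -/
def Gjac {N R : ℕ} (α : Fin N → ℝ) (c : Fin N → Fin R → ℝ → ℝ)
    (x : Fin N → Fin (R + 1) → ℝ) :
    Matrix (Fin N × Fin (R + 1)) (Fin N × Fin (R + 1)) ℝ :=
  Matrix.of fun p q =>
    deriv (fun t => gradJ α c (Function.update x q.1 (Function.update (x q.1) q.2 t)) p.1 p.2)
      (x q.1 q.2)

/-- The shape that Assumption 1 imposes on a single delay cost function. -/
def IsDelayCost (f : ℝ → ℝ) (χ : ℝ) : Prop :=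
  0 ≤ χ ∧ (∀ X : ℝ, X ≤ χ → f X = 0) ∧ StrictMonoOn f (Set.Ici χ) ∧
    ConvexOn ℝ (Set.Ici 0) f ∧ ContDiff ℝ 2 f

namespace IsDelayCost

variable {f : ℝ → ℝ} {χ X Y : ℝ}

theorem differentiable (h : IsDelayCost f χ) : Differentiable ℝ f :=
  h.2.2.2.2.differentiable (by norm_num)

theorem pos (h : IsDelayCost f χ) (hX : χ < X) : 0 < f X := by
  rw [← h.2.1 χ le_rfl]
  exact h.2.2.1 Set.self_mem_Ici hX.le hX

theorem nonneg (h : IsDelayCost f χ) (X : ℝ) : 0 ≤ f X := by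
  rcases le_or_gt X χ with hX | hX
  · exact (h.2.1 X hX).ge
  · exact (h.pos hX).le

theorem mono (h : IsDelayCost f χ) (hXY : X ≤ Y) : f X ≤ f Y := by
  rcases le_or_gt X χ with hX | hX
  · rw [h.2.1 X hX]
    exact h.nonneg Y
  · exact h.2.2.1.monotoneOn hX.le (hX.le.trans hXY) hXY

theorem deriv_eq_zero (h : IsDelayCost f χ) (hX : X ≤ χ) : deriv f X = 0 := by
  refine IsLocalMin.deriv_eq_zero (Filter.Eventually.of_forall fun Y => ?_)
  rw [h.2.1 X hX]
  exact h.nonneg Y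

theorem deriv_mono (h : IsDelayCost f χ) (hX : 0 ≤ X) (hXY : X ≤ Y) :
    deriv f X ≤ deriv f Y :=
  h.2.2.2.1.monotoneOn_deriv (fun x _ => h.differentiable x) hX (hX.trans hXY) hXY

theorem deriv_pos (h : IsDelayCost f χ) (hX : χ < X) : 0 < deriv f X := by
  have hs : 0 < slope f χ X := by
    rw [slope_def_field, h.2.1 χ le_rfl, sub_zero]
    exact div_pos (h.pos hX) (sub_pos.2 hX)
  exact hs.trans_le
    (h.2.2.2.1.slope_le_deriv h.1 (h.1.trans hX.le) hX (h.differentiable X))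

/-- On a congested route, a weakly smaller aggregated flow together with a weakly larger
marginal cost forces a weakly larger individual flow. -/
theorem flow_le_of_marginal_le (h : IsDelayCost f χ) (hY : 0 ≤ Y) (hYX : Y ≤ X)
    (hX : χ < X) {u v : ℝ} (hv : 0 ≤ v)
    (huv : f X + u * deriv f X ≤ f Y + v * deriv f Y) : u ≤ v := by
  refine le_of_mul_le_mul_right ?_ (h.deriv_pos hX)
  have := mul_le_mul_of_nonneg_left (h.deriv_mono hY hYX) hv
  linarith [h.mono hYX]

end IsDelayCost

/-- Marginal cost of player `i` on each delivery option. -/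
def marginal {N R : ℕ} (α : Fin N → ℝ) (c : Fin R → ℝ → ℝ)
    (x : Fin N → Fin (R + 1) → ℝ) (i : Fin N) : Fin (R + 1) → ℝ :=
  Fin.cons (α i) fun r => c r (aggFlow x r) + x i r.succ * deriv (c r) (aggFlow x r)

/-- Every player uses only options of minimal marginal cost. -/
def IsMarginalEq {N R : ℕ} (α : Fin N → ℝ) (c : Fin R → ℝ → ℝ)
    (x : Fin N → Fin (R + 1) → ℝ) : Prop :=
  ∀ i k l, 0 < x i k → marginal α c x i k ≤ marginal α c x i l

section

variable {N R : ℕ} {D α : Fin N → ℝ} {c : Fin R → ℝ → ℝ} {χ : Fin R → ℝ}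
  {x y : Fin N → Fin (R + 1) → ℝ}

@[simp] theorem marginal_zero (i : Fin N) : marginal α c x i 0 = α i := rfl

@[simp] theorem marginal_succ (i : Fin N) (r : Fin R) :
    marginal α c x i r.succ =
      c r (aggFlow x r) + x i r.succ * deriv (c r) (aggFlow x r) := rfl

theorem aggFlow_nonneg (hx : FeasProfile D x) (r : Fin R) : 0 ≤ aggFlow x r :=
  Finset.sum_nonneg fun i _ => (hx i).1 _

theorem sum_aggFlow (S : Finset (Fin R)) :
    ∑ r ∈ S, aggFlow x r = ∑ i, ∑ r ∈ S, x i r.succ :=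
  Finset.sum_comm

theorem aggFlow_update (i : Fin N) (z : Fin (R + 1) → ℝ) (r : Fin R) :
    aggFlow (Function.update x i z) r = aggFlow x r + (z r.succ - x i r.succ) := by
  unfold aggFlow
  rw [← Finset.add_sum_erase _ _ (Finset.mem_univ i),
    ← Finset.add_sum_erase _ (fun j => x j r.succ) (Finset.mem_univ i),
    Finset.sum_congr rfl fun j hj => by
      rw [Function.update_of_ne (Finset.ne_of_mem_erase hj)]]
  simp only [Function.update_self]
  ring

theorem hasDerivAt_cost_update (hc : ∀ r, Differentiable ℝ (c r)) (i : Fin N)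
    (d : Fin (R + 1) → ℝ) :
    HasDerivAt (fun t : ℝ => cost α (fun _ => c) i (Function.update x i (x i + t • d)))
      (∑ k, d k * marginal α c x i k) 0 := by
  have hlin : ∀ a b : ℝ, HasDerivAt (fun t : ℝ => a + t * b) b 0 := fun a b => by
    simpa using ((hasDerivAt_id (0 : ℝ)).mul_const b).const_add a
  have hroute : ∀ r : Fin R, HasDerivAt
      (fun t : ℝ => (x i r.succ + t * d r.succ) * c r (aggFlow x r + t * d r.succ))
      (d r.succ * marginal α c x i r.succ) 0 := fun r => by
    have h := (hlin (x i r.succ) (d r.succ)).mul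
      (((hc r) (aggFlow x r + 0 * d r.succ)).hasDerivAt.comp (0 : ℝ)
        (hlin (aggFlow x r) (d r.succ)))
    refine h.congr_deriv ?_
    simp only [zero_mul, add_zero, marginal_succ, Function.comp_apply]
    ring
  have h := ((hlin (x i 0) (d 0)).const_mul (α i)).add
    (HasDerivAt.fun_sum fun r (_ : r ∈ Finset.univ) => hroute r)
  rw [Fin.sum_univ_succ]
  refine (h.congr_deriv ?_).congr_of_eventuallyEq (Filter.Eventually.of_forall fun t => ?_)
  · rw [marginal_zero, mul_comm]
  · simp [cost, aggFlow_update]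

theorem deriv_nonneg_of_forall_le {g : ℝ → ℝ} {g' ε : ℝ} (hg : HasDerivAt g g' 0)
    (hε : 0 < ε) (h : ∀ t, 0 < t → t < ε → g 0 ≤ g t) : 0 ≤ g' := by
  have ht := (hasDerivWithinAt_iff_tendsto_slope' (s := Set.Ioi (0 : ℝ))
    (by simp)).1 hg.hasDerivWithinAt
  refine ge_of_tendsto ht ?_
  filter_upwards [Ioo_mem_nhdsGT hε] with t h0
  rw [slope_def_field]
  exact div_nonneg (sub_nonneg.2 (h t h0.1 h0.2)) (by linarith [h0.1])

theorem IsNash.isMarginalEq (hx : IsNash D α (fun _ => c) x)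
    (hc : ∀ r, Differentiable ℝ (c r)) : IsMarginalEq α c x := by
  intro i k l hk
  rcases eq_or_ne l k with rfl | hlk
  · exact le_rfl
  have hderiv := hasDerivAt_cost_update (α := α) (x := x) hc i
    (Pi.single l 1 - Pi.single k 1)
  have hsum : ∑ j, (Pi.single l 1 - Pi.single k 1 : Fin (R + 1) → ℝ) j *
      marginal α c x i j = marginal α c x i l - marginal α c x i k := by
    simp [sub_mul, Finset.sum_sub_distrib, Pi.single_apply]
  rw [hsum] at hderiv
  refine sub_nonneg.1 (deriv_nonneg_of_forall_le hderiv hk fun t ht0 htk => ?_)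
  simp only [zero_smul, add_zero, Function.update_eq_self]
  refine hx.2 i _ ⟨fun j => ?_, ?_⟩
  · have hj := (hx.1 i).1 j
    rcases eq_or_ne j k with rfl | hjk
    · simpa [hlk.symm] using htk.le
    · rcases eq_or_ne j l with rfl | hjl
      · simpa [hjk] using add_nonneg hj ht0.le
      · simpa [Pi.single_apply, hjk, hjl] using hj
  · simp [Finset.sum_add_distrib, ← Finset.mul_sum, (hx.1 i).2]

theorem IsMarginalEq.exists_multiplier (hx : IsMarginalEq α c x) (i : Fin N) :
    ∃ lam, (∀ k, lam ≤ marginal α c x i k) ∧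
      ∀ k, 0 < x i k → marginal α c x i k = lam := by
  obtain ⟨k₀, hk₀⟩ := Finite.exists_min (marginal α c x i)
  exact ⟨_, hk₀, fun k hk => (hx i k k₀ hk).antisymm (hk₀ k)⟩

theorem marginal_pos (hc : ∀ r, IsDelayCost (c r) (χ r)) {i : Fin N} {r : Fin R}
    (hi : 0 ≤ x i r.succ) (hr : χ r < aggFlow x r) : 0 < marginal α c x i r.succ := by
  rw [marginal_succ]
  exact add_pos_of_pos_of_nonneg ((hc r).pos hr) (mul_nonneg hi ((hc r).deriv_pos hr).le)

theorem IsMarginalEq.marginal_nonpos (hc : ∀ r, IsDelayCost (c r) (χ r))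
    (hx : IsMarginalEq α c x) {r : Fin R} (hr : aggFlow x r ≤ χ r) {i : Fin N}
    {k : Fin (R + 1)} (hk : 0 < x i k) : marginal α c x i k ≤ 0 := by
  refine (hx i k r.succ hk).trans_eq ?_
  simp [(hc r).2.1 _ hr, (hc r).deriv_eq_zero hr]

theorem IsMarginalEq.aggFlow_le (hc : ∀ r, IsDelayCost (c r) (χ r))
    (hx : IsMarginalEq α c x) {r : Fin R} (hr : aggFlow x r ≤ χ r) {i : Fin N}
    {s : Fin R} (hs : 0 < x i s.succ) : aggFlow x s ≤ χ s :=
  not_lt.1 fun h => (hx.marginal_nonpos hc hr hs).not_gt (marginal_pos hc hs.le h)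

/-- If some route is uncongested at equilibrium, nobody pays anything. -/
theorem IsMarginalEq.cost_eq_zero (hc : ∀ r, IsDelayCost (c r) (χ r))
    (hα : ∀ i, 0 ≤ α i) (hf : FeasProfile D x) (hx : IsMarginalEq α c x) {r : Fin R}
    (hr : aggFlow x r ≤ χ r) (i : Fin N) : cost α (fun _ => c) i x = 0 := by
  unfold cost
  rw [Finset.sum_eq_zero, add_zero]
  · rcases ((hf i).1 0).eq_or_lt with h | h
    · rw [← h, mul_zero]
    · have h0 : α i ≤ 0 := hx.marginal_nonpos hc hr h
      rw [h0.antisymm (hα i), zero_mul]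
  · intro s _
    rcases ((hf i).1 s.succ).eq_or_lt with h | h
    · rw [← h, zero_mul]
    · exact mul_eq_zero_of_right _ ((hc s).2.1 _ (hx.aggFlow_le hc hr h))

/-- An uncongested route in one equilibrium yields one in every equilibrium. -/
theorem IsMarginalEq.exists_aggFlow_le (hc : ∀ r, IsDelayCost (c r) (χ r))
    (hfx : FeasProfile D x) (hfy : FeasProfile D y)
    (hx : IsMarginalEq α c x) (hy : IsMarginalEq α c y) {r : Fin R}
    (hr : aggFlow x r ≤ χ r) : ∃ s, aggFlow y s ≤ χ s := by
  by_contra! hcong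
  have hxle : ∀ s, aggFlow x s ≤ χ s := fun s => by
    by_cases h : ∃ i, 0 < x i s.succ
    · obtain ⟨i, hi⟩ := h
      exact hx.aggFlow_le hc hr hi
    · push Not at h
      exact (Finset.sum_nonpos fun i _ => h i).trans (hc s).1
  have hlt : ∑ s, aggFlow x s < ∑ s, aggFlow y s :=
    Finset.sum_lt_sum_of_nonempty ⟨r, Finset.mem_univ r⟩
      fun s _ => (hxle s).trans_lt (hcong s)
  rw [sum_aggFlow, sum_aggFlow] at hlt
  obtain ⟨i, -, hi⟩ := Finset.exists_lt_of_sum_lt hlt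
  have hxD := (hfx i).2
  have hyD := (hfy i).2
  rw [Fin.sum_univ_succ] at hxD hyD
  have hx0 : 0 < x i 0 := by linarith [(hfy i).1 0]
  obtain ⟨s, -, hs⟩ := Finset.exists_lt_of_sum_lt hi
  have hys : 0 < y i s.succ := ((hfx i).1 _).trans_lt hs
  have h1 : α i ≤ 0 := hx.marginal_nonpos hc hr hx0
  have h2 : marginal α c y i s.succ ≤ α i := hy i s.succ 0 hys
  linarith [marginal_pos (α := α) hc hys.le (hcong s)]

theorem IsMarginalEq.aggFlow_le_aggFlow (hc : ∀ r, IsDelayCost (c r) (χ r))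
    (hfx : FeasProfile D x) (hfy : FeasProfile D y)
    (hx : IsMarginalEq α c x) (hy : IsMarginalEq α c y)
    (hxc : ∀ r, χ r < aggFlow x r) (hyc : ∀ r, χ r < aggFlow y r) (r : Fin R) :
    aggFlow y r ≤ aggFlow x r := by
  by_contra! hr
  set S := Finset.univ.filter fun s => aggFlow x s < aggFlow y s with hS
  have hlt : ∑ s ∈ S, aggFlow x s < ∑ s ∈ S, aggFlow y s :=
    Finset.sum_lt_sum_of_nonempty ⟨r, by simpa [hS] using hr⟩
      fun s hs => (Finset.mem_filter.1 hs).2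
  rw [sum_aggFlow, sum_aggFlow] at hlt
  obtain ⟨i, -, hi⟩ := Finset.exists_lt_of_sum_lt hlt
  obtain ⟨lx, hlx, hlx'⟩ := hx.exists_multiplier i
  obtain ⟨ly, hly, hly'⟩ := hy.exists_multiplier i
  rcases le_or_gt ly lx with hl | hl
  · refine hi.not_ge (Finset.sum_le_sum fun s hs => ?_)
    rcases ((hfy i).1 s.succ).eq_or_lt with h | h
    · exact h ▸ (hfx i).1 _
    · exact (hc s).flow_le_of_marginal_le (aggFlow_nonneg hfx s)
        (Finset.mem_filter.1 hs).2.le (hyc s) ((hfx i).1 _)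
        (((hly' _ h).trans_le hl).trans (hlx s.succ))
  · have h0 : x i 0 ≤ y i 0 := by
      rcases ((hfx i).1 0).eq_or_lt with h | h
      · exact h ▸ (hfy i).1 _
      · exact absurd ((hly 0).trans_eq (hlx' 0 h)) hl.not_ge
    have hcompl : ∑ s ∈ Sᶜ, x i s.succ ≤ ∑ s ∈ Sᶜ, y i s.succ := by
      refine Finset.sum_le_sum fun s hs => ?_
      rcases ((hfx i).1 s.succ).eq_or_lt with h | h
      · exact h ▸ (hfy i).1 _
      · exact (hc s).flow_le_of_marginal_le (aggFlow_nonneg hfy s)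
          (by simpa [hS] using hs) (hxc s) ((hfy i).1 _)
          (((hlx' _ h).trans_le hl.le).trans (hly s.succ))
    have hxD := (hfx i).2
    have hyD := (hfy i).2
    rw [Fin.sum_univ_succ, ← Finset.sum_add_sum_compl S] at hxD hyD
    linarith

/-- With equal congested aggregated flows, the player with the smaller multiplier has the
smaller flow on every route. -/
theorem flow_le_of_multiplier_le (hc : ∀ r, IsDelayCost (c r) (χ r))
    (hfx : FeasProfile D x) (hfy : FeasProfile D y)
    (hxc : ∀ r, χ r < aggFlow x r) (hagg : ∀ r, aggFlow y r = aggFlow x r) {i : Fin N}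
    {lx ly : ℝ} (hlx : ∀ k, 0 < x i k → marginal α c x i k = lx)
    (hly : ∀ k, ly ≤ marginal α c y i k) (hl : lx ≤ ly) (r : Fin R) :
    x i r.succ ≤ y i r.succ := by
  rcases ((hfx i).1 r.succ).eq_or_lt with h | h
  · exact h ▸ (hfy i).1 _
  · exact (hc r).flow_le_of_marginal_le (aggFlow_nonneg hfy r) (hagg r).le (hxc r)
      ((hfy i).1 _) (((hlx _ h).trans_le hl).trans (hly r.succ))

/-- With equal congested aggregated flows, a smaller multiplier forces equal strategies. -/
theorem strategy_eq_of_multiplier_le (hc : ∀ r, IsDelayCost (c r) (χ r))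
    (hfx : FeasProfile D x) (hfy : FeasProfile D y)
    (hxc : ∀ r, χ r < aggFlow x r) (hagg : ∀ r, aggFlow y r = aggFlow x r) {i : Fin N}
    {lx ly : ℝ} (hlx : ∀ k, lx ≤ marginal α c x i k)
    (hlx' : ∀ k, 0 < x i k → marginal α c x i k = lx)
    (hly : ∀ k, ly ≤ marginal α c y i k)
    (hly' : ∀ k, 0 < y i k → marginal α c y i k = ly) (hl : lx ≤ ly) : x i = y i := by
  have hroute := flow_le_of_multiplier_le hc hfx hfy hxc hagg hlx' hly hl
  have hxD := (hfx i).2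
  have hyD := (hfy i).2
  rw [Fin.sum_univ_succ] at hxD hyD
  have hsum := Finset.sum_le_sum fun r (_ : r ∈ Finset.univ) => hroute r
  have hsum_eq : ∑ r : Fin R, x i r.succ = ∑ r : Fin R, y i r.succ := by
    refine hsum.antisymm ?_
    rcases hl.eq_or_lt with hl' | hl'
    · exact Finset.sum_le_sum fun r _ => flow_le_of_multiplier_le hc hfy hfx
        (fun s => hagg s ▸ hxc s) (fun s => (hagg s).symm) hly' hlx hl'.ge r
    · have h0 : x i 0 ≤ y i 0 := by
        rcases ((hfx i).1 0).eq_or_lt with h | h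
        · exact h ▸ (hfy i).1 _
        · exact absurd ((hly 0).trans_eq (hlx' 0 h)) hl'.not_ge
      linarith
  have heq := (Finset.sum_eq_sum_iff_of_le fun r _ => hroute r).1 hsum_eq
  funext k
  refine Fin.cases ?_ (fun r => heq r (Finset.mem_univ r)) k
  linarith

end

/-- **Theorem 1 (Statement 0).** Under Assumptions 1 and 2 (player-identical delayed
delivery cost functions `c_r` with thresholds `χ_r`), the Nash equilibria of the green
routing game are essentially unique: any two Nash equilibria give every player the
same cost. -/
theorem essentially_unique_NE {N R : ℕ} (D α : Fin N → ℝ) (c : Fin R → ℝ → ℝ)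
    (χ : Fin R → ℝ)
    (hD : ∀ i, 0 ≤ D i) (hα : ∀ i, 0 ≤ α i)
    (hA1 : Assumption1 (fun _ : Fin N => c) fun _ : Fin N => χ)
    (x xh : Fin N → Fin (R + 1) → ℝ)
    (hx : IsNash D α (fun _ => c) x) (hxh : IsNash D α (fun _ => c) xh) :
    ∀ i, cost α (fun _ => c) i x = cost α (fun _ => c) i xh := by
  intro i
  have hc : ∀ r, IsDelayCost (c r) (χ r) := hA1 i
  have hmx := hx.isMarginalEq fun r => (hc r).differentiable
  have hmxh := hxh.isMarginalEq fun r => (hc r).differentiable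
  by_cases hfree : ∃ r, aggFlow x r ≤ χ r
  · obtain ⟨r, hr⟩ := hfree
    obtain ⟨s, hs⟩ := hmx.exists_aggFlow_le hc hx.1 hxh.1 hmxh hr
    rw [hmx.cost_eq_zero hc hα hx.1 hr, hmxh.cost_eq_zero hc hα hxh.1 hs]
  have hcong : ∀ r, χ r < aggFlow x r := by simpa using hfree
  have hcongh : ∀ r, χ r < aggFlow xh r := fun r => not_le.1 fun hr =>
    hfree (hmxh.exists_aggFlow_le hc hxh.1 hx.1 hmx hr)
  have hagg : ∀ r, aggFlow xh r = aggFlow x r := fun r =>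
    (hmx.aggFlow_le_aggFlow hc hx.1 hxh.1 hmxh hcong hcongh r).antisymm
      (hmxh.aggFlow_le_aggFlow hc hxh.1 hx.1 hmx hcongh hcong r)
  obtain ⟨l, hl, hl'⟩ := hmx.exists_multiplier i
  obtain ⟨lh, hlh, hlh'⟩ := hmxh.exists_multiplier i
  have heq : x i = xh i := by
    rcases le_total l lh with h | h
    · exact strategy_eq_of_multiplier_le hc hx.1 hxh.1 hcong hagg hl hl' hlh hlh' h
    · exact (strategy_eq_of_multiplier_le hc hxh.1 hx.1 hcongh (fun r => (hagg r).symm)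
        hlh hlh' hl hl' h).symm
  simp only [cost, heq, hagg]

end GreenRouting
end

section
/- Suppose Assumptions 1 and 2 hold. Let (x, λ, μ) and (x̂, λ̂, μ̂) be two KKT points of the green routing game whose aggregated flows satisfy X_r > χ_r and X̂_r > χ_r for every route r ∈ {1,…,R}. Then for every player i and every route r ∈ {1,…,R}: (a) if λ̂^i ≤ λ^i and X̂_r ≥ X_r, then x̂^i_r ≤ x^i_r; (b) if λ̂^i ≥ λ^i and X̂_r ≤ X_r, then x̂^i_r ≥ x^i_r. -/
open scoped BigOperators

noncomputable section GreenRouting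

theorem deriv_pos_of_convexOn_of_strictMonoOn {f : ℝ → ℝ} {a t : ℝ}
    (ha : 0 ≤ a) (hmono : StrictMonoOn f (Set.Ici a)) (hconv : ConvexOn ℝ (Set.Ici 0) f)
    (hdiff : Differentiable ℝ f) (hat : a < t) : 0 < deriv f t := by
  have hslope : slope f a t ≤ deriv f t :=
    hconv.slope_le_deriv ha (ha.trans hat.le) hat (hdiff t)
  refine lt_of_lt_of_le ?_ hslope
  rw [slope_def_field]
  exact div_pos (sub_pos.2 (hmono Set.self_mem_Ici hat.le hat)) (sub_pos.2 hat)

theorem IsKKT.flow_le_of_aggFlow_le {N R : ℕ} {D α : Fin N → ℝ} {c : Fin R → ℝ → ℝ}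
    {χ : Fin R → ℝ} (hA1 : Assumption1 (fun _ : Fin N => c) fun _ : Fin N => χ)
    {x xh : Fin N → Fin (R + 1) → ℝ} {lam lamh : Fin N → ℝ}
    {mu muh : Fin N → Fin (R + 1) → ℝ}
    (hK : IsKKT D α c x lam mu) (hKh : IsKKT D α c xh lamh muh) {i : Fin N} {r : Fin R}
    (hX : χ r < aggFlow x r) (hlam : lamh i ≤ lam i) (hle : aggFlow x r ≤ aggFlow xh r) :
    xh i r.succ ≤ x i r.succ := by
  obtain ⟨hχ, -, hmono, hconv, hsmooth⟩ := hA1 i r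
  have hdiff : Differentiable ℝ (c r) := hsmooth.differentiable (by norm_num)
  have hpos := deriv_pos_of_convexOn_of_strictMonoOn hχ hmono hconv hdiff hX
  have hX0 : 0 ≤ aggFlow x r := hχ.trans hX.le
  have hderiv : deriv (c r) (aggFlow x r) ≤ deriv (c r) (aggFlow xh r) :=
    hconv.monotoneOn_deriv (fun t _ => hdiff t) hX0 (hX0.trans hle) hle
  have hcost : c r (aggFlow x r) ≤ c r (aggFlow xh r) :=
    hmono.monotoneOn hX.le (hX.le.trans hle) hle
  obtain ⟨-, hstat, -, hcomp⟩ := hK i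
  obtain ⟨-, hstath, -, hcomph⟩ := hKh i
  obtain ⟨hx0, -, hmu⟩ := hcomp r.succ
  by_contra! hlt
  have hxh : 0 < xh i r.succ := hx0.trans_lt hlt
  have hmuh : muh i r.succ = 0 :=
    (mul_eq_zero.1 (hcomph r.succ).2.1).resolve_right hxh.ne'
  have hgrow := mul_le_mul_of_nonneg_left hderiv hxh.le
  have hstrict := mul_lt_mul_of_pos_right hlt hpos
  linarith [hstat r, hstath r]

/-- **Lemma 2, items 1–2 (Statement 2).** Under Assumptions 1 and 2, for two KKT points
whose aggregated flows exceed the thresholds on every route: if `λ̂^i ≤ λ^i` and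
`X̂_r ≥ X_r` then `x̂^i_r ≤ x^i_r`, and if `λ̂^i ≥ λ^i` and `X̂_r ≤ X_r` then
`x̂^i_r ≥ x^i_r`. -/
theorem KKT_flow_comparison_weak
    {N R : ℕ} (D α : Fin N → ℝ) (c : Fin R → ℝ → ℝ) (χ : Fin R → ℝ)
    (hD : ∀ i, 0 ≤ D i) (hα : ∀ i, 0 ≤ α i)
    (hA1 : Assumption1 (fun _ : Fin N => c) fun _ : Fin N => χ)
    (x xh : Fin N → Fin (R + 1) → ℝ) (lam lamh : Fin N → ℝ)
    (mu muh : Fin N → Fin (R + 1) → ℝ)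
    (hK : IsKKT D α c x lam mu) (hKh : IsKKT D α c xh lamh muh)
    (hX : ∀ r, χ r < aggFlow x r) (hXh : ∀ r, χ r < aggFlow xh r) :
    ∀ (i : Fin N) (r : Fin R),
      (lamh i ≤ lam i → aggFlow x r ≤ aggFlow xh r → xh i r.succ ≤ x i r.succ) ∧
      (lam i ≤ lamh i → aggFlow xh r ≤ aggFlow x r → x i r.succ ≤ xh i r.succ) := by
  intro i r
  exact ⟨fun hlam hle => hK.flow_le_of_aggFlow_le hA1 hKh (hX r) hlam hle,
    fun hlam hle => hKh.flow_le_of_aggFlow_le hA1 hK (hXh r) hlam hle⟩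

end GreenRouting
end

section
/- Suppose Assumptions 1 and 2 hold. Let (x, λ, μ) and (x̂, λ̂, μ̂) be two KKT points of the green routing game whose aggregated flows satisfy X_r > χ_r and X̂_r > χ_r for every route r ∈ {1,…,R}. Then for every player i and every route r ∈ {1,…,R}: (a) if λ̂^i < λ^i and X̂_r ≥ X_r, then either x̂^i_r < x^i_r or x̂^i_r = x^i_r = 0; (b) if λ̂^i > λ^i and X̂_r ≤ X_r, then either x̂^i_r > x^i_r or x̂^i_r = x^i_r = 0. -/
open scoped BigOperators

noncomputable section GreenRouting

theorem marginal_cost_le {f : ℝ → ℝ} {χ X Y a b : ℝ} (hχ : 0 ≤ χ)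
    (hmono : StrictMonoOn f (Set.Ici χ)) (hconv : ConvexOn ℝ (Set.Ici 0) f)
    (hdiff : Differentiable ℝ f) (hX : χ < X) (hXY : X ≤ Y) (ha : 0 ≤ a) (hab : a ≤ b) :
    f X + a * deriv f X ≤ f Y + b * deriv f Y := by
  have hfXY : f X ≤ f Y := hmono.monotoneOn hX.le (hX.le.trans hXY) hXY
  have hderiv : deriv f X ≤ deriv f Y :=
    hconv.monotoneOn_deriv (fun z _ => hdiff z) (hχ.trans hX.le)
      (hχ.trans (hX.le.trans hXY)) hXY
  have hpos : 0 ≤ deriv f X := by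
    have hslope := hconv.slope_le_deriv hχ (hχ.trans hX.le) hX (hdiff X)
    have hlt : f χ < f X := hmono Set.self_mem_Ici hX.le hX
    rw [slope_def_field] at hslope
    exact (div_nonneg (sub_nonneg.2 hlt.le) (sub_nonneg.2 hX.le)).trans hslope
  have := mul_le_mul hab hderiv hpos (ha.trans hab)
  linarith

theorem IsKKT.flow_lt_or_eq_zero {N R : ℕ} {D α : Fin N → ℝ} {c : Fin R → ℝ → ℝ}
    {χ : Fin R → ℝ} (hA1 : Assumption1 (fun _ : Fin N => c) fun _ : Fin N => χ)
    {x y : Fin N → Fin (R + 1) → ℝ} {lam lam' : Fin N → ℝ}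
    {mu mu' : Fin N → Fin (R + 1) → ℝ}
    (hK : IsKKT D α c x lam mu) (hK' : IsKKT D α c y lam' mu')
    {i : Fin N} {r : Fin R} (hX : χ r < aggFlow x r)
    (hlam : lam' i < lam i) (hXY : aggFlow x r ≤ aggFlow y r) :
    y i r.succ < x i r.succ ∨ (y i r.succ = 0 ∧ x i r.succ = 0) := by
  by_contra! h
  obtain ⟨hxy, hne⟩ := h
  obtain ⟨-, hs, -, hc⟩ := hK i
  obtain ⟨-, hs', -, hc'⟩ := hK' i
  have hx := (hc r.succ).1
  obtain ⟨hy, hcomp, -⟩ := hc' r.succ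
  have hy0 : y i r.succ ≠ 0 := fun h0 => hne h0 (le_antisymm (h0 ▸ hxy) hx)
  have hmu : mu' i r.succ = 0 := (mul_eq_zero.1 hcomp).resolve_right hy0
  obtain ⟨hχ, -, hmono, hconv, hdiff⟩ := hA1 i r
  have hle := marginal_cost_le hχ hmono hconv (hdiff.differentiable two_ne_zero) hX hXY hx hxy
  linarith [hs r, hs' r, (hc r.succ).2.2]

/-- **Lemma 2, items 3–4 (Statement 3).** Under Assumptions 1 and 2, for two KKT points
whose aggregated flows exceed the thresholds on every route: if `λ̂^i < λ^i` and
`X̂_r ≥ X_r` then `x̂^i_r < x^i_r` or `x̂^i_r = x^i_r = 0`, and if `λ̂^i > λ^i` and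
`X̂_r ≤ X_r` then `x̂^i_r > x^i_r` or `x̂^i_r = x^i_r = 0`. -/
theorem KKT_flow_comparison_strict
    {N R : ℕ} (D α : Fin N → ℝ) (c : Fin R → ℝ → ℝ) (χ : Fin R → ℝ)
    (hD : ∀ i, 0 ≤ D i) (hα : ∀ i, 0 ≤ α i)
    (hA1 : Assumption1 (fun _ : Fin N => c) fun _ : Fin N => χ)
    (x xh : Fin N → Fin (R + 1) → ℝ) (lam lamh : Fin N → ℝ)
    (mu muh : Fin N → Fin (R + 1) → ℝ)
    (hK : IsKKT D α c x lam mu) (hKh : IsKKT D α c xh lamh muh)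
    (hX : ∀ r, χ r < aggFlow x r) (hXh : ∀ r, χ r < aggFlow xh r) :
    ∀ (i : Fin N) (r : Fin R),
      (lamh i < lam i → aggFlow x r ≤ aggFlow xh r →
        xh i r.succ < x i r.succ ∨ (xh i r.succ = 0 ∧ x i r.succ = 0)) ∧
      (lam i < lamh i → aggFlow xh r ≤ aggFlow x r →
        x i r.succ < xh i r.succ ∨ (xh i r.succ = 0 ∧ x i r.succ = 0)) := by
  intro i r
  exact ⟨fun h hle => hK.flow_lt_or_eq_zero hA1 hKh (hX r) h hle,
    fun h hle => (hKh.flow_lt_or_eq_zero hA1 hK (hXh r) h hle).imp_right And.symm⟩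

end GreenRouting
end

section
/- Suppose Assumptions 1 and 2 hold. Let (x, λ, μ) and (x̂, λ̂, μ̂) be two KKT points of the green routing game whose aggregated flows satisfy X_r > χ_r and X̂_r > χ_r for every route r ∈ {1,…,R}. Then for every player i: if λ̂^i < λ^i then x̂^i_0 = 0, and if λ̂^i > λ^i then x^i_0 = 0. -/
open scoped BigOperators

noncomputable section GreenRouting

/-- At a KKT point, a player whose demand multiplier is strictly below the ICEV price `α i`
uses no ICEVs. -/
theorem IsKKT.icev_eq_zero {N R : ℕ} {D α : Fin N → ℝ} {c : Fin R → ℝ → ℝ}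
    {x : Fin N → Fin (R + 1) → ℝ} {lam : Fin N → ℝ} {mu : Fin N → Fin (R + 1) → ℝ}
    (hK : IsKKT D α c x lam mu) {i : Fin N} (h : lam i < α i) : x i 0 = 0 := by
  obtain ⟨hstat, -, -, hcomp⟩ := hK i
  have hmu : mu i 0 ≠ 0 := ne_of_gt (by linarith)
  exact (mul_eq_zero.mp (hcomp 0).2.1).resolve_left hmu

/-- At a KKT point, the demand multiplier is at most the ICEV price `α i`. -/
theorem IsKKT.lam_le {N R : ℕ} {D α : Fin N → ℝ} {c : Fin R → ℝ → ℝ}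
    {x : Fin N → Fin (R + 1) → ℝ} {lam : Fin N → ℝ} {mu : Fin N → Fin (R + 1) → ℝ}
    (hK : IsKKT D α c x lam mu) (i : Fin N) : lam i ≤ α i := by
  obtain ⟨hstat, -, -, hcomp⟩ := hK i
  linarith [(hcomp 0).2.2]

/-- **Lemma 2, second claim (Statement 4).** Under Assumptions 1 and 2, for two KKT
points whose aggregated flows exceed the thresholds on every route: if `λ̂^i < λ^i`
then `x̂^i_0 = 0`, and if `λ̂^i > λ^i` then `x^i_0 = 0`. -/
theorem KKT_icev_comparison
    {N R : ℕ} (D α : Fin N → ℝ) (c : Fin R → ℝ → ℝ) (χ : Fin R → ℝ)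
    (hD : ∀ i, 0 ≤ D i) (hα : ∀ i, 0 ≤ α i)
    (hA1 : Assumption1 (fun _ : Fin N => c) fun _ : Fin N => χ)
    (x xh : Fin N → Fin (R + 1) → ℝ) (lam lamh : Fin N → ℝ)
    (mu muh : Fin N → Fin (R + 1) → ℝ)
    (hK : IsKKT D α c x lam mu) (hKh : IsKKT D α c xh lamh muh)
    (hX : ∀ r, χ r < aggFlow x r) (hXh : ∀ r, χ r < aggFlow xh r) :
    ∀ i : Fin N, (lamh i < lam i → xh i 0 = 0) ∧ (lam i < lamh i → x i 0 = 0) := by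
  exact fun i => ⟨fun h => hKh.icev_eq_zero (h.trans_le (hK.lam_le i)),
    fun h => hK.icev_eq_zero (h.trans_le (hKh.lam_le i))⟩

end GreenRouting
end

section
/- Suppose Assumptions 1 and 2 hold. Let (x, λ, μ) and (x̂, λ̂, μ̂) be two KKT points of the green routing game whose aggregated flows satisfy X_r > χ_r and X̂_r > χ_r for every route r ∈ {1,…,R}. Then the aggregated flows of the two KKT points coincide: X_r = X̂_r for every route r ∈ {1,…,R}. -/
open scoped BigOperators

noncomputable section GreenRouting

/-- The derivative of a function that is differentiable and monotone on `[a, ∞)` is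
nonnegative on `(a, ∞)`. -/
theorem deriv_nonneg_of_monotoneOn_Ici {f : ℝ → ℝ} {a t : ℝ}
    (hf : MonotoneOn f (Set.Ici a)) (ht : a < t) : 0 ≤ deriv f t := by
  rw [← derivWithin_of_mem_nhds (Ici_mem_nhds ht)]
  exact hf.derivWithin_nonneg

/-- On a route whose aggregated flow strictly increases, a player whose multiplier `lam i` does
not increase does not increase her flow. -/
theorem IsKKT.flow_le_of_aggFlow_lt {N R : ℕ} {D α : Fin N → ℝ} {c : Fin R → ℝ → ℝ}
    {x xh : Fin N → Fin (R + 1) → ℝ} {lam lamh : Fin N → ℝ} {mu muh : Fin N → Fin (R + 1) → ℝ}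
    (hK : IsKKT D α c x lam mu) (hKh : IsKKT D α c xh lamh muh) {i : Fin N} {r : Fin R}
    (hlam : lamh i ≤ lam i) (hc : c r (aggFlow x r) < c r (aggFlow xh r))
    (hd : deriv (c r) (aggFlow x r) ≤ deriv (c r) (aggFlow xh r))
    (hd0 : 0 ≤ deriv (c r) (aggFlow x r)) : xh i r.succ ≤ x i r.succ := by
  by_contra! hlt
  obtain ⟨-, hs, -, hx⟩ := hK i
  obtain ⟨-, hsh, -, hxh⟩ := hKh i
  have hx := hx r.succ
  have hmu : muh i r.succ = 0 :=
    (mul_eq_zero.mp (hxh r.succ).2.1).resolve_right (by linarith)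
  have hmul := mul_le_mul hlt.le hd hd0 (hxh r.succ).1
  linarith [hs r, hsh r]

/-- On a route whose aggregated flow does not increase, a player whose multiplier `lam i`
strictly increases does not decrease her flow. -/
theorem IsKKT.flow_le_of_lam_lt {N R : ℕ} {D α : Fin N → ℝ} {c : Fin R → ℝ → ℝ}
    {x xh : Fin N → Fin (R + 1) → ℝ} {lam lamh : Fin N → ℝ} {mu muh : Fin N → Fin (R + 1) → ℝ}
    (hK : IsKKT D α c x lam mu) (hKh : IsKKT D α c xh lamh muh) {i : Fin N} {r : Fin R}
    (hlam : lam i < lamh i) (hc : c r (aggFlow xh r) ≤ c r (aggFlow x r))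
    (hd : deriv (c r) (aggFlow xh r) ≤ deriv (c r) (aggFlow x r))
    (hd0 : 0 ≤ deriv (c r) (aggFlow xh r)) : x i r.succ ≤ xh i r.succ := by
  by_contra! hlt
  obtain ⟨-, hs, -, hx⟩ := hK i
  obtain ⟨-, hsh, -, hxh⟩ := hKh i
  have hxh := hxh r.succ
  have hmu : mu i r.succ = 0 :=
    (mul_eq_zero.mp (hx r.succ).2.1).resolve_right (by linarith)
  have hmul := mul_le_mul hlt.le hd hd0 (hx r.succ).1
  linarith [hs r, hsh r]

/-- A player whose multiplier `lam i` strictly increases does not decrease her ICEV flow. -/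
theorem IsKKT.flow_zero_le_of_lam_lt {N R : ℕ} {D α : Fin N → ℝ} {c : Fin R → ℝ → ℝ}
    {x xh : Fin N → Fin (R + 1) → ℝ} {lam lamh : Fin N → ℝ} {mu muh : Fin N → Fin (R + 1) → ℝ}
    (hK : IsKKT D α c x lam mu) (hKh : IsKKT D α c xh lamh muh) {i : Fin N}
    (hlam : lam i < lamh i) : x i 0 ≤ xh i 0 := by
  obtain ⟨ha, -, -, hx⟩ := hK i
  obtain ⟨hah, -, -, hxh⟩ := hKh i
  have hzero : x i 0 = 0 :=
    (mul_eq_zero.mp (hx 0).2.1).resolve_left (by linarith [(hxh 0).2.2])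
  exact hzero ▸ (hxh 0).1

/-- One-sided comparison of the aggregated flows of two KKT points, for route costs that are
strictly increasing with monotone nonnegative derivatives beyond the thresholds. -/
theorem IsKKT.aggFlow_le {N R : ℕ} {D α : Fin N → ℝ} {c : Fin R → ℝ → ℝ} {χ : Fin R → ℝ}
    {x xh : Fin N → Fin (R + 1) → ℝ} {lam lamh : Fin N → ℝ} {mu muh : Fin N → Fin (R + 1) → ℝ}
    (hmono : ∀ r, StrictMonoOn (c r) (Set.Ici (χ r)))
    (hderiv : ∀ r, MonotoneOn (deriv (c r)) (Set.Ici (χ r)))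
    (hK : IsKKT D α c x lam mu) (hKh : IsKKT D α c xh lamh muh)
    (hX : ∀ r, χ r < aggFlow x r) (hXh : ∀ r, χ r < aggFlow xh r) (r : Fin R) :
    aggFlow xh r ≤ aggFlow x r := by
  by_contra! hr
  let S : Finset (Fin R) := {s | aggFlow x s < aggFlow xh s}
  have hplayer : ∀ i, ∑ s ∈ S, (xh i s.succ - x i s.succ) ≤ 0 := by
    intro i
    rcases le_or_gt (lamh i) (lam i) with hlam | hlam
    · refine Finset.sum_nonpos fun s hs => sub_nonpos.mpr ?_
      have hs : aggFlow x s < aggFlow xh s := by simpa [S] using hs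
      exact hK.flow_le_of_aggFlow_lt hKh hlam (hmono s (hX s).le (hXh s).le hs)
        (hderiv s (hX s).le (hXh s).le hs.le)
        (deriv_nonneg_of_monotoneOn_Ici (hmono s).monotoneOn (hX s))
    · have hcompl : 0 ≤ ∑ s ∈ Sᶜ, (xh i s.succ - x i s.succ) := by
        refine Finset.sum_nonneg fun s hs => sub_nonneg.mpr ?_
        have hs : aggFlow xh s ≤ aggFlow x s := by simpa [S] using hs
        exact hK.flow_le_of_lam_lt hKh hlam
          ((hmono s).monotoneOn (hXh s).le (hX s).le hs) (hderiv s (hXh s).le (hX s).le hs)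
          (deriv_nonneg_of_monotoneOn_Ici (hmono s).monotoneOn (hXh s))
      have hsplit := Finset.sum_add_sum_compl S fun s => xh i s.succ - x i s.succ
      have hdem := (hK i).2.2.1
      have hdemh := (hKh i).2.2.1
      rw [Fin.sum_univ_succ] at hdem hdemh
      rw [Finset.sum_sub_distrib (s := Finset.univ)] at hsplit
      linarith [hK.flow_zero_le_of_lam_lt hKh hlam]
  have hpos : 0 < ∑ s ∈ S, (aggFlow xh s - aggFlow x s) :=
    Finset.sum_pos (fun s hs => sub_pos.mpr (by simpa [S] using hs)) ⟨r, by simpa [S] using hr⟩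
  simp only [aggFlow, ← Finset.sum_sub_distrib] at hpos
  rw [Finset.sum_comm] at hpos
  exact hpos.not_ge (Finset.sum_nonpos fun i _ => hplayer i)

/-- **Lemma 3 (Statement 5).** Under Assumptions 1 and 2, two KKT points whose
aggregated flows exceed the thresholds on every route have identical aggregated
flows: `X_r = X̂_r` for every route `r`. -/
theorem KKT_aggFlows_coincide
    {N R : ℕ} (D α : Fin N → ℝ) (c : Fin R → ℝ → ℝ) (χ : Fin R → ℝ)
    (hD : ∀ i, 0 ≤ D i) (hα : ∀ i, 0 ≤ α i)
    (hA1 : Assumption1 (fun _ : Fin N => c) fun _ : Fin N => χ)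
    (x xh : Fin N → Fin (R + 1) → ℝ) (lam lamh : Fin N → ℝ)
    (mu muh : Fin N → Fin (R + 1) → ℝ)
    (hK : IsKKT D α c x lam mu) (hKh : IsKKT D α c xh lamh muh)
    (hX : ∀ r, χ r < aggFlow x r) (hXh : ∀ r, χ r < aggFlow xh r) :
    ∀ r : Fin R, aggFlow x r = aggFlow xh r := by
  rcases Nat.eq_zero_or_pos N with rfl | hN
  · simp [aggFlow]
  have hA := hA1 ⟨0, hN⟩
  have hderiv : ∀ r, MonotoneOn (deriv (c r)) (Set.Ici (χ r)) := fun r =>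
    have hdiff : Differentiable ℝ (c r) := (hA r).2.2.2.2.differentiable (by norm_num)
    ((hA r).2.2.2.1.monotoneOn_deriv fun t _ => hdiff t).mono
      (Set.Ici_subset_Ici.mpr (hA r).1)
  have hmono : ∀ r, StrictMonoOn (c r) (Set.Ici (χ r)) := fun r => (hA r).2.2.1
  exact fun r => le_antisymm (hKh.aggFlow_le hmono hderiv hK hXh hX r)
    (hK.aggFlow_le hmono hderiv hKh hX hXh r)

end GreenRouting
end

section
/- There exists an instance of the green routing game satisfying Assumption 1 (but not Assumption 2) whose Nash equilibria are not essentially unique: that is, there exist N, R, demands D^i ≥ 0, pollution cost coefficients α^i ≥ 0, and cost functions c^i_r satisfying Assumption 1, together with two Nash equilibria x and x̂ of the resulting game and a player i such that J^i(x) ≠ J^i(x̂). -/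
open scoped BigOperators

noncomputable section GreenRouting

theorem hasDerivAt_max_zero_pow (n : ℕ) (x : ℝ) :
    HasDerivAt (fun t : ℝ => max t 0 ^ (n + 2)) ((n + 2) * max x 0 ^ (n + 1)) x := by
  rcases lt_trichotomy x 0 with hx | rfl | hx
  · have h : (fun t : ℝ => max t 0 ^ (n + 2)) =ᶠ[nhds x] fun _ => 0 := by
      filter_upwards [eventually_lt_nhds hx] with t ht
      simp [max_eq_right ht.le]
    simpa [max_eq_right hx.le] using (hasDerivAt_const x (0 : ℝ)).congr_of_eventuallyEq h
  · have h : (fun t : ℝ => max t 0 ^ (n + 2)) =o[nhds 0] fun t => t := by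
      refine Asymptotics.IsBigO.trans_isLittleO (g := fun t : ℝ => t ^ (n + 2)) ?_
        (Asymptotics.isLittleO_pow_id (by omega))
      refine Asymptotics.IsBigO.of_bound 1 (Filter.Eventually.of_forall fun t => ?_)
      rw [one_mul, norm_pow, norm_pow]
      gcongr
      rw [Real.norm_eq_abs, Real.norm_eq_abs, abs_of_nonneg (le_max_right t 0)]
      exact max_le (le_abs_self t) (abs_nonneg t)
    rw [hasDerivAt_iff_isLittleO]
    simpa using h
  · have h : (fun t : ℝ => max t 0 ^ (n + 2)) =ᶠ[nhds x] fun t => t ^ (n + 2) := by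
      filter_upwards [eventually_gt_nhds hx] with t ht
      simp [max_eq_left ht.le]
    simpa [max_eq_left hx.le] using (hasDerivAt_pow (n + 2) x).congr_of_eventuallyEq h

theorem contDiff_max_zero_pow (n : ℕ) : ContDiff ℝ n fun t : ℝ => max t 0 ^ (n + 1) := by
  induction n with
  | zero => exact contDiff_zero.2 (by fun_prop)
  | succ n ih =>
    rw [Nat.cast_succ, contDiff_succ_iff_deriv]
    refine ⟨fun x => (hasDerivAt_max_zero_pow n x).differentiableAt, by simp, ?_⟩
    rw [funext fun x => (hasDerivAt_max_zero_pow n x).deriv]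
    exact contDiff_const.mul ih

/-- The cubic ramp with cost-free threshold `a`. -/
def cubicRamp (a X : ℝ) : ℝ := max (X - a) 0 ^ 3

theorem cubicRamp_nonneg (a X : ℝ) : 0 ≤ cubicRamp a X :=
  pow_nonneg (le_max_right _ _) 3

theorem cubicRamp_of_le {a X : ℝ} (h : X ≤ a) : cubicRamp a X = 0 := by
  simp [cubicRamp, max_eq_right (sub_nonpos.2 h)]

theorem cubicRamp_of_ge {a X : ℝ} (h : a ≤ X) : cubicRamp a X = (X - a) ^ 3 := by
  rw [cubicRamp, max_eq_left (sub_nonneg.2 h)]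

theorem contDiff_cubicRamp (a : ℝ) : ContDiff ℝ 2 (cubicRamp a) :=
  (contDiff_max_zero_pow 2).comp (contDiff_id.sub contDiff_const)

theorem convexOn_cubicRamp (a : ℝ) : ConvexOn ℝ Set.univ (cubicRamp a) := by
  have h : ConvexOn ℝ Set.univ fun X : ℝ => max (X - a) 0 :=
    ((convexOn_id convex_univ).sub (concaveOn_const a convex_univ)).sup
      (convexOn_const 0 convex_univ)
  exact h.pow (fun X _ => le_max_right _ _) 3

theorem strictMonoOn_cubicRamp (a : ℝ) : StrictMonoOn (cubicRamp a) (Set.Ici a) := by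
  intro X hX Y hY h
  rw [cubicRamp_of_ge hX, cubicRamp_of_ge hY]
  exact pow_lt_pow_left₀ (sub_lt_sub_right h a) (sub_nonneg.2 hX) (by norm_num)

theorem assumption1_cubicRamp {N R : ℕ} {χ : Fin N → Fin R → ℝ} (hχ : ∀ i r, 0 ≤ χ i r) :
    Assumption1 (fun i r => cubicRamp (χ i r)) χ := fun i r =>
  ⟨hχ i r, fun _ => cubicRamp_of_le, strictMonoOn_cubicRamp _,
    (convexOn_cubicRamp _).subset (Set.subset_univ _) (convex_Ici 0), contDiff_cubicRamp _⟩

/-- In the two-player, one-route example, the first player has no pollution cost and splits her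
unit demand with `s` on the route, while the second player uses only the route. -/
def exampleProfile (s : ℝ) : Fin 2 → Fin (1 + 1) → ℝ := ![![1 - s, s], ![0, 1]]

/-- The thresholds of the example: congestion never affects the first player. -/
def exampleThreshold : Fin 2 → Fin 1 → ℝ := ![fun _ => 10, fun _ => 0]

theorem cost_exampleProfile_one (α : Fin 2 → ℝ) {s : ℝ} (hs : 0 ≤ s) :
    cost α (fun i r => cubicRamp (exampleThreshold i r)) 1 (exampleProfile s) = (s + 1) ^ 3 := by
  simp [cost, aggFlow, exampleProfile, exampleThreshold,
    cubicRamp_of_ge (show (0 : ℝ) ≤ s + 1 by linarith)]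

theorem isNash_exampleProfile {s : ℝ} (hs : 0 ≤ s) (hs1 : s ≤ 1) :
    IsNash (fun _ => 1) ![0, 20] (fun i r => cubicRamp (exampleThreshold i r))
      (exampleProfile s) := by
  refine ⟨fun i => ?_, fun i y hy => ?_⟩
  · fin_cases i <;> simp [Feasible, exampleProfile, Fin.forall_fin_two, hs, hs1]
  · obtain ⟨hy, hsum⟩ := hy
    have h0 := hy 0
    have h1 := hy 1
    rw [Fin.sum_univ_two] at hsum
    fin_cases i
    · have := mul_nonneg h1 (cubicRamp_nonneg 10 (y 1 + 1))
      simpa [cost, aggFlow, exampleProfile, exampleThreshold,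
        cubicRamp_of_le (show s + 1 ≤ 10 by linarith)] using this
    · refine (cost_exampleProfile_one _ hs).trans_le ?_
      have key : (s + 1) ^ 3 ≤ 20 * y 0 + y 1 * (s + y 1) ^ 3 := by
        obtain ⟨t, ht⟩ : ∃ t, y 1 = t := ⟨_, rfl⟩
        rw [ht] at h1 hsum ⊢
        rw [eq_sub_of_add_eq hsum] at h0 ⊢
        have hA : (s + 1) ^ 3 ≤ 2 ^ 3 := by gcongr; linarith
        have hB : (s + 1) ^ 2 + (s + 1) * (s + t) + (s + t) ^ 2 ≤ 12 := by nlinarith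
        have hC : t * ((s + 1) ^ 2 + (s + 1) * (s + t) + (s + t) ^ 2) ≤ 12 := by
          refine le_trans (mul_le_of_le_one_left (by positivity) (by linarith)) hB
        nlinarith [mul_nonneg h0 (sub_nonneg.2 hA), mul_nonneg h0 (sub_nonneg.2 hC)]
      simpa [cost, aggFlow, exampleProfile, exampleThreshold,
        cubicRamp_of_ge (show (0 : ℝ) ≤ s + y 1 by linarith)] using key

/-- **Example of Sec. III-A (Statement 9).** There is an instance of the green routing
game satisfying Assumption 1 whose Nash equilibria are not essentially unique: two Nash
equilibria give some player different costs. -/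
theorem exists_game_with_non_essentially_unique_NE :
    ∃ (N R : ℕ) (D α : Fin N → ℝ) (c : Fin N → Fin R → ℝ → ℝ)
      (χ : Fin N → Fin R → ℝ) (x xh : Fin N → Fin (R + 1) → ℝ) (i : Fin N),
      (∀ j, 0 ≤ D j) ∧ (∀ j, 0 ≤ α j) ∧ Assumption1 c χ ∧
      IsNash D α c x ∧ IsNash D α c xh ∧
      cost α c i x ≠ cost α c i xh := by
  refine ⟨2, 1, fun _ => 1, ![0, 20], fun i r => cubicRamp (exampleThreshold i r),
    exampleThreshold, exampleProfile 0, exampleProfile 1, 1, fun _ => zero_le_one, ?_,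
    assumption1_cubicRamp ?_, isNash_exampleProfile le_rfl zero_le_one,
    isNash_exampleProfile zero_le_one le_rfl, ?_⟩
  · simp [Fin.forall_fin_two]
  · simp [Fin.forall_fin_two, exampleThreshold]
  · rw [cost_exampleProfile_one _ le_rfl, cost_exampleProfile_one _ zero_le_one]
    norm_num

end GreenRouting
end

section
/- Suppose Assumption 1 holds. For every x ∈ 𝒳 such that X_r ≤ χ^i_r for all players i and routes r, the partial gradient of player i's cost satisfies ∇_{x^i} J^i(x) = (α^i, 0, …, 0). Consequently, if there exist two distinct profiles x, x' ∈ 𝒳 with X_r ≤ χ^i_r and X'_r ≤ χ^i_r for all i and r, then the aggregated gradient map F is not strongly monotone: there is no a > 0 such that (x'−x)ᵀ(F(x')−F(x)) ≥ a·‖x'−x‖² for all x, x' ∈ 𝒳. -/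
open scoped BigOperators

noncomputable section GreenRouting

/-- A differentiable function vanishing on `(-∞, b]` has zero derivative at every point there. -/
theorem hasDerivAt_zero_of_eq_zero_on_Iic {f : ℝ → ℝ} {b X : ℝ}
    (hf : DifferentiableAt ℝ f X) (h0 : ∀ Y ≤ b, f Y = 0) (hX : X ≤ b) :
    HasDerivAt f 0 X := by
  have hc : HasDerivWithinAt f 0 (Set.Iic X) X :=
    (hasDerivWithinAt_const X (Set.Iic X) (0 : ℝ)).congr
      (fun Y hY => h0 Y (le_trans hY hX)) (h0 X hX)
  have hd := (uniqueDiffWithinAt_Iic X).eq_deriv _ hf.hasDerivAt.hasDerivWithinAt hc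
  simpa [hd] using hf.hasDerivAt

/-- The coordinates of a profile along a variation of the single entry `x i k`. -/
theorem hasDerivAt_update_update_apply {ι κ : Type*} [DecidableEq ι] [DecidableEq κ]
    (x : ι → κ → ℝ) (i j : ι) (k l : κ) (t : ℝ) :
    HasDerivAt (fun t => Function.update x i (Function.update (x i) k t) j l)
      (if j = i ∧ l = k then 1 else 0) t := by
  by_cases hj : j = i
  · subst hj
    by_cases hl : l = k
    · subst hl
      simpa using hasDerivAt_id' t
    · simpa [hl] using hasDerivAt_const t (x j l)
  · simpa [hj] using hasDerivAt_const t (x j l)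

/-- On the cost-free region the partial gradient only sees the ICEV term. -/
theorem gradJ_eq_of_aggFlow_le {N R : ℕ} {α : Fin N → ℝ} {c : Fin N → Fin R → ℝ → ℝ}
    {χ : Fin N → Fin R → ℝ} (hA1 : Assumption1 c χ) {x : Fin N → Fin (R + 1) → ℝ}
    {i : Fin N} (hx : ∀ r, aggFlow x r ≤ χ i r) (k : Fin (R + 1)) :
    gradJ α c x i k = if k = 0 then α i else 0 := by
  have hu : Function.update x i (Function.update (x i) k (x i k)) = x := by simp
  have hroute : ∀ r : Fin R, HasDerivAt
      (fun t => Function.update x i (Function.update (x i) k t) i r.succ *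
        c i r (aggFlow (Function.update x i (Function.update (x i) k t)) r)) 0 (x i k) := by
    intro r
    obtain ⟨-, h0, -, -, hdiff⟩ := hA1 i r
    have hc : HasDerivAt (c i r) 0
        (aggFlow (Function.update x i (Function.update (x i) k (x i k))) r) := by
      rw [hu]
      exact hasDerivAt_zero_of_eq_zero_on_Iic
        (hdiff.differentiable (by norm_num)).differentiableAt h0 (hx r)
    have hagg : HasDerivAt
        (fun t => aggFlow (Function.update x i (Function.update (x i) k t)) r) _ (x i k) :=
      HasDerivAt.fun_sum fun j _ => hasDerivAt_update_update_apply x i j k r.succ (x i k)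
    have hmul := (hasDerivAt_update_update_apply x i i k r.succ (x i k)).mul
      (hc.comp (x i k) hagg)
    refine hmul.congr_deriv ?_
    simp only [Function.comp_apply, hu, h0 _ (hx r)]
    ring
  have hsum := HasDerivAt.fun_sum fun (r : Fin R) (_ : r ∈ Finset.univ) => hroute r
  have hcost := ((hasDerivAt_update_update_apply x i i k 0 (x i k)).const_mul (α i)).add hsum
  refine (hcost.congr_deriv ?_).deriv
  by_cases hk : k = 0 <;> simp [hk, eq_comm]

/-- Under Assumption 1, at every feasible profile whose aggregated
flows all lie in the cost-free intervals, each player's partial gradient equals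
`(α^i, 0, …, 0)`; consequently, if two distinct such feasible profiles exist, the
aggregated gradient map `F` is not strongly monotone on `𝒳`. -/
theorem gradient_constant_on_costfree_and_not_strongly_monotone
    {N R : ℕ} (D α : Fin N → ℝ) (c : Fin N → Fin R → ℝ → ℝ) (χ : Fin N → Fin R → ℝ)
    (hD : ∀ i, 0 ≤ D i) (hα : ∀ i, 0 ≤ α i) (hA1 : Assumption1 c χ) :
    (∀ x : Fin N → Fin (R + 1) → ℝ, FeasProfile D x →
      (∀ i r, aggFlow x r ≤ χ i r) →
      ∀ i : Fin N, gradJ α c x i 0 = α i ∧ ∀ r : Fin R, gradJ α c x i r.succ = 0) ∧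
    ((∃ x x' : Fin N → Fin (R + 1) → ℝ, FeasProfile D x ∧ FeasProfile D x' ∧ x ≠ x' ∧
        (∀ i r, aggFlow x r ≤ χ i r) ∧ (∀ i r, aggFlow x' r ≤ χ i r)) →
      ¬ ∃ a : ℝ, 0 < a ∧
        ∀ x x' : Fin N → Fin (R + 1) → ℝ, FeasProfile D x → FeasProfile D x' →
          a * ∑ i, ∑ k, (x' i k - x i k) ^ 2 ≤
            ∑ i, ∑ k, (x' i k - x i k) * (gradJ α c x' i k - gradJ α c x i k)) := by
  have hgrad : ∀ x : Fin N → Fin (R + 1) → ℝ, (∀ i r, aggFlow x r ≤ χ i r) →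
      ∀ i k, gradJ α c x i k = if k = 0 then α i else 0 :=
    fun x hx i k => gradJ_eq_of_aggFlow_le hA1 (hx i) k
  refine ⟨fun x _ hx i => ⟨by simp [hgrad x hx], fun r => by simp [hgrad x hx]⟩, ?_⟩
  rintro ⟨x, x', hF, hF', hne, hx, hx'⟩ ⟨a, ha, hmono⟩
  have hle := hmono x x' hF hF'
  simp only [hgrad x hx, hgrad x' hx', sub_self, mul_zero, Finset.sum_const_zero] at hle
  obtain ⟨i, hi⟩ := Function.ne_iff.mp hne
  obtain ⟨k, hk⟩ := Function.ne_iff.mp hi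
  have hpos : 0 < ∑ i, ∑ k, (x' i k - x i k) ^ 2 :=
    Finset.sum_pos' (fun i _ => Finset.sum_nonneg fun k _ => sq_nonneg _)
      ⟨i, Finset.mem_univ i, Finset.sum_pos' (fun k _ => sq_nonneg _)
        ⟨k, Finset.mem_univ k, sq_pos_of_ne_zero (sub_ne_zero.mpr hk.symm)⟩⟩
  exact absurd hle (mul_pos ha hpos).not_ge

end GreenRouting
end

section
/- Let N ∈ ℕ, ζ > 0, and η ∈ ℝ^N, and define ξ ∈ ℝ^N by ξ_i = 1 + η_i/(2ζ). If ‖η‖² ≤ 4ζ², then the N×N symmetric matrix ζI + ζξξᵀ − (1/(4ζ))ηηᵀ is positive semidefinite. -/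
open scoped BigOperators

/-- For `ζ > 0` and `η ∈ ℝ^N` with `‖η‖² ≤ 4ζ²`, the symmetric matrix
`ζ I + ζ ξ ξᵀ - (1/(4ζ)) η ηᵀ`, where `ξ_i = 1 + η_i / (2ζ)`, is positive
semidefinite. -/
theorem quadratic_form_decomposition_posSemidef
    {N : ℕ} (ζ : ℝ) (hζ : 0 < ζ) (η : Fin N → ℝ)
    (hη : ∑ i, (η i) ^ 2 ≤ 4 * ζ ^ 2) :
    (ζ • (1 : Matrix (Fin N) (Fin N) ℝ) +
      ζ • Matrix.vecMulVec (fun i => 1 + η i / (2 * ζ)) (fun i => 1 + η i / (2 * ζ)) -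
      (1 / (4 * ζ)) • Matrix.vecMulVec η η).PosSemidef := by
  have dotProduct_vecMulVec (v y : Fin N → ℝ) :
      y ⬝ᵥ (Matrix.vecMulVec v v).mulVec y = (v ⬝ᵥ y) ^ 2 := by
    rw [Matrix.vecMulVec_mulVec]
    simp [dotProduct_comm y v, sq]
  refine Matrix.PosSemidef.of_dotProduct_mulVec_nonneg ?_ fun y => ?_
  · ext i j
    simp [Matrix.vecMulVec_apply, Matrix.one_apply, mul_comm, eq_comm]
  · have cauchy_schwarz : (η ⬝ᵥ y) ^ 2 ≤ 4 * ζ ^ 2 * (y ⬝ᵥ y) := by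
      have hy : y ⬝ᵥ y = ∑ i, y i ^ 2 := by simp [dotProduct, sq]
      rw [hy]
      exact (Finset.sum_mul_sq_le_sq_mul_sq Finset.univ η y).trans (by gcongr)
    have hdiv : 1 / (4 * ζ) * (η ⬝ᵥ y) ^ 2 ≤ ζ * (y ⬝ᵥ y) := by
      rw [one_div_mul_eq_div, div_le_iff₀ (by positivity)]
      linarith
    simp only [star_trivial, Matrix.sub_mulVec, Matrix.add_mulVec, Matrix.smul_mulVec,
      Matrix.one_mulVec, dotProduct_sub, dotProduct_add, dotProduct_smul, smul_eq_mul,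
      dotProduct_vecMulVec]
    have hξ := mul_nonneg hζ.le (sq_nonneg ((fun i => 1 + η i / (2 * ζ)) ⬝ᵥ y))
    linarith
end
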